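/- arXiv:2406.00494 — 4 statements merged into one kernel-verified Lean document; each statement's English description precedes it below -/
import Mathlib

section
/- For every activation pattern A (a function assigning to each pair (i,j), 1 ≤ i ≤ l, 1 ≤ j ≤ d_i, a value in {0,1}), the activation region R(A) = {x ∈ ℝⁿ : A_f(x)(i,j) = A(i,j) for all i, j} is a convex subset of ℝⁿ. -/
open Matrix

/-- ReLU activation. -/
noncomputable def relu (t : ℝ) : ℝ := max t 0

/-- `hlayer d W b x i` is the hidden vector `h^{(i+1)}(x)` (paper layer `i+1`), so
`hlayer d W b x l = f(x)` for an `l`-layer ReLU network. -/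
noncomputable def hlayer (d : ℕ → ℕ)
    (W : ∀ i : ℕ, Matrix (Fin (d (i+1))) (Fin (d i)) ℝ)
    (b : ∀ i : ℕ, Fin (d (i+1)) → ℝ)
    (x : Fin (d 0) → ℝ) : (i : ℕ) → Fin (d (i+1)) → ℝ
  | 0 => W 0 *ᵥ x + b 0
  | i + 1 => W (i+1) *ᵥ (fun j => relu (hlayer d W b x i j)) + b (i+1)

/-- The activation pattern of the network at `x`: `actPat l d W b x i j = true` iff
`h^{(i+1)}_j(x) > 0` (paper: `A_f(x)(i+1, j) = 1`), for paper layers `1 ≤ i+1 ≤ l`. -/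
noncomputable def actPat (l : ℕ) (d : ℕ → ℕ)
    (W : ∀ i : ℕ, Matrix (Fin (d (i+1))) (Fin (d i)) ℝ)
    (b : ∀ i : ℕ, Fin (d (i+1)) → ℝ)
    (x : Fin (d 0) → ℝ) : ∀ i : Fin l, Fin (d (i.val+1)) → Bool :=
  fun i j => decide (0 < hlayer d W b x i.val j)

/-- ReLU is linear on nonnegative combinations of two reals that are both positive or both
nonpositive. -/
lemma relu_add_mul_of_pos_iff {s t u v : ℝ} (hs : 0 ≤ s) (ht : 0 ≤ t) (h : 0 < u ↔ 0 < v) :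
    relu (s * u + t * v) = s * relu u + t * relu v := by
  unfold relu
  by_cases hu : 0 < u
  · have hv := h.1 hu
    rw [max_eq_left hu.le, max_eq_left hv.le, max_eq_left (by positivity)]
  · have hv : v ≤ 0 := not_lt.1 (mt h.2 hu)
    have hu : u ≤ 0 := not_lt.1 hu
    rw [max_eq_right hu, max_eq_right hv, max_eq_right]
    · simp
    · exact add_nonpos (mul_nonpos_of_nonneg_of_nonpos hs hu)
        (mul_nonpos_of_nonneg_of_nonpos ht hv)

/-- Convex combinations preserve a common strict sign. -/
lemma convex_comb_pos_iff {s t u v : ℝ} (hs : 0 ≤ s) (ht : 0 ≤ t) (hst : s + t = 1)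
    (h : 0 < u ↔ 0 < v) : 0 < s * u + t * v ↔ 0 < u := by
  refine ⟨fun hpos => ?_, fun hu => convex_Ioi (0 : ℝ) hu (h.1 hu) hs ht hst⟩
  by_contra hu
  exact absurd (convex_Iic (0 : ℝ) (not_lt.1 hu) (not_lt.1 (mt h.2 hu)) hs ht hst)
    (not_le.2 hpos)

/-- If `x` and `y` have the same activations in all layers before `k`, then layer `k` respects
convex combinations of `x` and `y`. -/
lemma hlayer_convex_comb (d : ℕ → ℕ)
    (W : ∀ i : ℕ, Matrix (Fin (d (i+1))) (Fin (d i)) ℝ)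
    (b : ∀ i : ℕ, Fin (d (i+1)) → ℝ) {x y : Fin (d 0) → ℝ} {s t : ℝ}
    (hs : 0 ≤ s) (ht : 0 ≤ t) (hst : s + t = 1) (k : ℕ)
    (h : ∀ i < k, ∀ j, 0 < hlayer d W b x i j ↔ 0 < hlayer d W b y i j) :
    hlayer d W b (s • x + t • y) k = s • hlayer d W b x k + t • hlayer d W b y k := by
  have affine : ∀ {p q : ℕ} (M : Matrix (Fin p) (Fin q) ℝ) (c : Fin p → ℝ) (u v : Fin q → ℝ),
      M *ᵥ (s • u + t • v) + c = s • (M *ᵥ u + c) + t • (M *ᵥ v + c) := by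
    intro p q M c u v
    have hc : c = s • c + t • c := by rw [← add_smul, hst, one_smul]
    rw [mulVec_add, mulVec_smul, mulVec_smul, smul_add, smul_add]
    nth_rewrite 1 [hc]
    abel
  induction k with
  | zero => exact affine _ _ _ _
  | succ k ih =>
    have hrelu : (fun j => relu (hlayer d W b (s • x + t • y) k j)) =
        s • (fun j => relu (hlayer d W b x k j)) + t • fun j => relu (hlayer d W b y k j) := by
      funext j
      rw [ih fun i hi => h i (hi.trans k.lt_succ_self)]
      exact relu_add_mul_of_pos_iff hs ht (h k k.lt_succ_self j)
    simp only [hlayer]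
    rw [hrelu, affine]

/-- For every activation pattern `A`, the activation region
`R(A) = {x : A_f(x) = A}` is a convex subset of `ℝⁿ`. -/
theorem activation_region_convex
    (l n m : ℕ) (hl : 1 ≤ l) (d : ℕ → ℕ) (hd0 : d 0 = n) (hdl : d (l+1) = m)
    (W : ∀ i : ℕ, Matrix (Fin (d (i+1))) (Fin (d i)) ℝ)
    (b : ∀ i : ℕ, Fin (d (i+1)) → ℝ)
    (A : ∀ i : Fin l, Fin (d (i.val+1)) → Bool) :
    Convex ℝ {x : Fin (d 0) → ℝ |
      ∀ (i : Fin l) (j : Fin (d (i.val+1))), actPat l d W b x i j = A i j} := by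
  intro x hx y hy s t hs ht hst i j
  have same : ∀ k < l, ∀ j, 0 < hlayer d W b x k j ↔ 0 < hlayer d W b y k j := fun k hk j =>
    decide_eq_decide.1 ((hx ⟨k, hk⟩ j).trans (hy ⟨k, hk⟩ j).symm)
  rw [← hx i j]
  refine decide_eq_decide.2 ?_
  rw [hlayer_convex_comb d W b hs ht hst i fun k hk => same k (hk.trans i.isLt)]
  exact convex_comb_pos_iff hs ht hst (same i i.isLt j)
end

section
/- If x, y ∈ ℝⁿ have the same activation pattern, i.e. A_f(x)(i,j) = A_f(y)(i,j) for all 1 ≤ i ≤ l and 1 ≤ j ≤ d_i, then for every λ ∈ [0,1] the point (1−λ)x + λy also has that same activation pattern, and f((1−λ)x + λy) = (1−λ)f(x) + λf(y). -/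
open Matrix

theorem convex_combination_pos_iff {s t lam : ℝ} (hst : 0 < s ↔ 0 < t)
    (hlam0 : 0 ≤ lam) (hlam1 : lam ≤ 1) :
    0 < (1 - lam) * s + lam * t ↔ 0 < s := by
  by_cases hs : 0 < s
  · have ht := hst.mp hs
    refine iff_of_true ?_ hs
    rcases hlam0.eq_or_lt with rfl | hpos
    · simpa using hs
    · have := mul_nonneg (sub_nonneg.mpr hlam1) hs.le
      have := mul_pos hpos ht
      linarith
  · have ht : t ≤ 0 := not_lt.mp (mt hst.mpr hs)
    refine iff_of_false (not_lt.mpr ?_) hs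
    have := mul_nonpos_of_nonneg_of_nonpos (sub_nonneg.mpr hlam1) (not_lt.mp hs)
    have := mul_nonpos_of_nonneg_of_nonpos hlam0 ht
    linarith

theorem relu_convex_combination {s t lam : ℝ} (hst : 0 < s ↔ 0 < t)
    (hlam0 : 0 ≤ lam) (hlam1 : lam ≤ 1) :
    relu ((1 - lam) * s + lam * t) = (1 - lam) * relu s + lam * relu t := by
  have hiff := convex_combination_pos_iff hst hlam0 hlam1
  unfold relu
  by_cases hs : 0 < s
  · rw [max_eq_left (hiff.mpr hs).le, max_eq_left hs.le, max_eq_left (hst.mp hs).le]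
  · rw [max_eq_right (not_lt.mp (mt hiff.mp hs)), max_eq_right (not_lt.mp hs),
      max_eq_right (not_lt.mp (mt hst.mpr hs))]
    simp

theorem mulVec_add_convex_combination {m n : Type*} [Fintype n] (A : Matrix m n ℝ)
    (c : m → ℝ) (u v : n → ℝ) (lam : ℝ) :
    A *ᵥ ((1 - lam) • u + lam • v) + c
      = (1 - lam) • (A *ᵥ u + c) + lam • (A *ᵥ v + c) := by
  rw [Matrix.mulVec_add, Matrix.mulVec_smul, Matrix.mulVec_smul]
  module

theorem hlayer_convex_combination (d : ℕ → ℕ)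
    (W : ∀ i : ℕ, Matrix (Fin (d (i+1))) (Fin (d i)) ℝ)
    (b : ∀ i : ℕ, Fin (d (i+1)) → ℝ) (x y : Fin (d 0) → ℝ)
    {lam : ℝ} (hlam0 : 0 ≤ lam) (hlam1 : lam ≤ 1) (k : ℕ)
    (hxy : ∀ i < k, ∀ j, 0 < hlayer d W b x i j ↔ 0 < hlayer d W b y i j) :
    hlayer d W b ((1 - lam) • x + lam • y) k
      = (1 - lam) • hlayer d W b x k + lam • hlayer d W b y k := by
  induction k with
  | zero => exact mulVec_add_convex_combination _ _ _ _ _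
  | succ k ih =>
    simp only [hlayer]
    rw [← mulVec_add_convex_combination, ih fun i hi => hxy i (hi.trans k.lt_succ_self)]
    congr 2
    ext j
    exact relu_convex_combination (hxy k k.lt_succ_self j) hlam0 hlam1

/-- If `x, y` share the same activation pattern, then for every
`λ ∈ [0,1]` the point `(1−λ)x + λy` also has that pattern, and
`f((1−λ)x + λy) = (1−λ)f(x) + λf(y)`. -/
theorem same_pattern_convex_combination
    (l n m : ℕ) (hl : 1 ≤ l) (d : ℕ → ℕ) (hd0 : d 0 = n) (hdl : d (l+1) = m)
    (W : ∀ i : ℕ, Matrix (Fin (d (i+1))) (Fin (d i)) ℝ)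
    (b : ∀ i : ℕ, Fin (d (i+1)) → ℝ)
    (x y : Fin (d 0) → ℝ)
    (hxy : ∀ (i : Fin l) (j : Fin (d (i.val+1))),
      actPat l d W b x i j = actPat l d W b y i j)
    (lam : ℝ) (hlam0 : 0 ≤ lam) (hlam1 : lam ≤ 1) :
    (∀ (i : Fin l) (j : Fin (d (i.val+1))),
      actPat l d W b ((1 - lam) • x + lam • y) i j = actPat l d W b x i j) ∧
    hlayer d W b ((1 - lam) • x + lam • y) l
      = (1 - lam) • hlayer d W b x l + lam • hlayer d W b y l := by
  have hpos : ∀ i < l, ∀ j, 0 < hlayer d W b x i j ↔ 0 < hlayer d W b y i j :=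
    fun i hi j => decide_eq_decide.mp (hxy ⟨i, hi⟩ j)
  refine ⟨fun i j => decide_eq_decide.mpr ?_,
    hlayer_convex_combination d W b x y hlam0 hlam1 l hpos⟩
  rw [hlayer_convex_combination d W b x y hlam0 hlam1 i fun k hk => hpos k (hk.trans i.isLt)]
  exact convex_combination_pos_iff (hpos i i.isLt j) hlam0 hlam1
end

section
/- Let x ∈ ℝⁿ and let η = (η⁽¹⁾, …, η⁽ˡ⁾) with η⁽ⁱ⁾ ∈ ℝ^{d_i} satisfy the feasibility constraints for x, i.e. for all 1 ≤ i ≤ l and 1 ≤ j ≤ d_i, η⁽ⁱ⁾_j ≥ 1/2 when h⁽ⁱ⁾_j(x) ≥ 0 and η⁽ⁱ⁾_j < 1/2 otherwise; assume moreover η⁽ⁱ⁾_j ≠ 1/2 for all (i,j). Then the sigmoid-surrogate network converges to the ReLU network as α → ∞: lim_{α→∞} f̄_α(x, η) = f(x). -/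
open Matrix

/-- The offset sigmoid `s_α(t) = (1 + exp(−α(t − 1/2)))⁻¹`. -/
noncomputable def sigm (α t : ℝ) : ℝ := (1 + Real.exp (-α * (t - 1/2)))⁻¹
/-- Sigmoid-surrogate network: `hbar α d W b x η i` is `h̄^{(i+1)}(x, η)`, where `η i`
plays the role of the activation variables `η^{(i+1)}` of paper layer `i+1` (so
`s_α(η i)` multiplies `h̄^{(i+1)}` componentwise, i.e. `diag(s_α(η^{(i+1)}))·h̄^{(i+1)}`),
and `hbar α d W b x η l = f̄_α(x, η)`. -/
noncomputable def hbar (α : ℝ) (d : ℕ → ℕ)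
    (W : ∀ i : ℕ, Matrix (Fin (d (i+1))) (Fin (d i)) ℝ)
    (b : ∀ i : ℕ, Fin (d (i+1)) → ℝ)
    (x : Fin (d 0) → ℝ) (η : ∀ i : ℕ, Fin (d (i+1)) → ℝ) : (i : ℕ) → Fin (d (i+1)) → ℝ
  | 0 => W 0 *ᵥ x + b 0
  | i + 1 => W (i+1) *ᵥ (fun j => sigm α (η i j) * hbar α d W b x η i j) + b (i+1)

/-- Above the threshold the offset sigmoid tends to `1` as the slope grows. -/
theorem tendsto_sigm_one {t : ℝ} (ht : 1/2 < t) :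
    Filter.Tendsto (fun α : ℝ => sigm α t) Filter.atTop (nhds 1) := by
  have h : Filter.Tendsto (fun α : ℝ => -α * (t - 1/2)) Filter.atTop Filter.atBot :=
    Filter.tendsto_neg_atTop_atBot.atBot_mul_const (sub_pos.mpr ht)
  simpa [sigm] using ((Real.tendsto_exp_atBot.comp h).const_add 1).inv₀ (by norm_num)

/-- Below the threshold the offset sigmoid tends to `0` as the slope grows. -/
theorem tendsto_sigm_zero {t : ℝ} (ht : t < 1/2) :
    Filter.Tendsto (fun α : ℝ => sigm α t) Filter.atTop (nhds 0) := by
  have h : Filter.Tendsto (fun α : ℝ => -α * (t - 1/2)) Filter.atTop Filter.atTop :=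
    Filter.tendsto_neg_atTop_atBot.atBot_mul_const_of_neg (sub_neg.mpr ht)
  exact (Filter.tendsto_atTop_add_const_left _ 1
    (Real.tendsto_exp_atTop.comp h)).inv_tendsto_atTop

/-- Gating a convergent preactivation by a sigmoid whose activation variable lies strictly on
the correct side of the threshold gives the ReLU of the limit. -/
theorem tendsto_sigm_mul_relu {t y : ℝ} {u : ℝ → ℝ}
    (hu : Filter.Tendsto u Filter.atTop (nhds y))
    (hpos : 0 ≤ y → 1/2 ≤ t) (hneg : y < 0 → t < 1/2) (hne : t ≠ 1/2) :
    Filter.Tendsto (fun α : ℝ => sigm α t * u α) Filter.atTop (nhds (relu y)) := by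
  rcases le_or_gt 0 y with hy | hy
  · simpa [relu, hy] using (tendsto_sigm_one (lt_of_le_of_ne (hpos hy) hne.symm)).mul hu
  · simpa [relu, hy.le] using (tendsto_sigm_zero (hneg hy)).mul hu

/-- If `η` satisfies the feasibility constraints for `x`
(`η^{(i)}_j ≥ 1/2` when `h^{(i)}_j(x) ≥ 0`, `η^{(i)}_j < 1/2` otherwise, for all
`1 ≤ i ≤ l`), and moreover `η^{(i)}_j ≠ 1/2` for all `(i,j)`, then the sigmoid-surrogate
network converges to the ReLU network as `α → ∞`: `lim_{α→∞} f̄_α(x, η) = f(x)`. -/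
theorem surrogate_tendsto_relu
    (l n m : ℕ) (hl : 1 ≤ l) (d : ℕ → ℕ) (hd0 : d 0 = n) (hdl : d (l+1) = m)
    (W : ∀ i : ℕ, Matrix (Fin (d (i+1))) (Fin (d i)) ℝ)
    (b : ∀ i : ℕ, Fin (d (i+1)) → ℝ)
    (x : Fin (d 0) → ℝ) (η : ∀ i : ℕ, Fin (d (i+1)) → ℝ)
    (hfeas : ∀ i < l, ∀ j : Fin (d (i+1)),
      (0 ≤ hlayer d W b x i j → 1/2 ≤ η i j) ∧
      (hlayer d W b x i j < 0 → η i j < 1/2))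
    (hne : ∀ i < l, ∀ j : Fin (d (i+1)), η i j ≠ 1/2) :
    Filter.Tendsto (fun α : ℝ => hbar α d W b x η l) Filter.atTop
      (nhds (hlayer d W b x l)) := by
  suffices h : ∀ i ≤ l, Filter.Tendsto (fun α : ℝ => hbar α d W b x η i) Filter.atTop
      (nhds (hlayer d W b x i)) from h l le_rfl
  intro i
  induction i with
  | zero => exact fun _ => tendsto_const_nhds
  | succ i ih =>
    intro hi
    have hgate : Filter.Tendsto (fun (α : ℝ) j => sigm α (η i j) * hbar α d W b x η i j)
        Filter.atTop (nhds fun j => relu (hlayer d W b x i j)) :=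
      tendsto_pi_nhds.mpr fun j =>
        tendsto_sigm_mul_relu (tendsto_pi_nhds.mp (ih (Nat.le_of_succ_le hi)) j)
          (hfeas i hi j).1 (hfeas i hi j).2 (hne i hi j)
    have hcont : Continuous fun v : Fin (d (i+1)) → ℝ => W (i+1) *ᵥ v + b (i+1) := by
      fun_prop
    exact (hcont.tendsto _).comp hgate
end

section
/- Let h, h̄, D, D̄ ∈ ℝ with h ≠ 0, h̄ ≠ 0 and (D/h) · (D̄/h̄) > 0 (the discrete and surrogate ratios have the same strict sign). Let ν ∈ {0, 1}, α > 0 and η ∈ ℝ. Define ŝgn(t) = 1 if t ≥ 0 and −1 if t < 0; the projected steepest activation-descent component ∂ν := ŝgn(ν − 1/2) · min( ŝgn(D/h) · ŝgn(ν − 1/2), 0 ); and the surrogate gradient component ∂η := D̄ · (1/h̄) · s_α(η) · (1 − s_α(η)) · α, where s_α(t) = (1 + exp(−α(t − 1/2)))⁻¹. Then ∂ν · ∂η ≥ 0, with strict inequality ∂ν · ∂η > 0 whenever ∂ν ≠ 0. In particular ŝgn(∂η) = ∂ν whenever ∂ν ≠ 0. -/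
/-- `ŝgn(t) = 1` if `t ≥ 0`, `−1` if `t < 0` (the `{−1,1}`-valued sign `2·sgn(t) − 1`). -/
noncomputable def sgnhat (t : ℝ) : ℝ := if 0 ≤ t then 1 else -1

theorem sgnhat_of_nonneg {t : ℝ} (ht : 0 ≤ t) : sgnhat t = 1 := if_pos ht

theorem sgnhat_of_neg {t : ℝ} (ht : t < 0) : sgnhat t = -1 := if_neg ht.not_ge

theorem sigm_pos (α t : ℝ) : 0 < sigm α t := by
  unfold sigm
  positivity

theorem sigm_lt_one (α t : ℝ) : sigm α t < 1 :=
  inv_lt_one_of_one_lt₀ (lt_add_of_pos_right 1 (Real.exp_pos _))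

/-- Let `h ≠ 0`, `h̄ ≠ 0` with `(D/h)·(D̄/h̄) > 0`, `ν ∈ {0,1}`,
`α > 0`, `η ∈ ℝ`. With the projected steepest activation-descent component
`∂ν = ŝgn(ν − 1/2)·min(ŝgn(D/h)·ŝgn(ν − 1/2), 0)` and the surrogate gradient component
`∂η = D̄·(1/h̄)·s_α(η)·(1 − s_α(η))·α`, one has `∂ν·∂η ≥ 0`, with `∂ν·∂η > 0` whenever
`∂ν ≠ 0`; in particular `ŝgn(∂η) = ∂ν` whenever `∂ν ≠ 0`. -/
theorem steepest_direction_consistent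
    (h hbar D Dbar : ℝ) (hh : h ≠ 0) (hhb : hbar ≠ 0)
    (hsign : 0 < (D / h) * (Dbar / hbar))
    (ν : ℝ) (hν : ν = 0 ∨ ν = 1) (α : ℝ) (hα : 0 < α) (η : ℝ) :
    0 ≤ (sgnhat (ν - 1/2) * min (sgnhat (D / h) * sgnhat (ν - 1/2)) 0) *
        (Dbar * (1 / hbar) * (sigm α η * (1 - sigm α η)) * α) ∧
    (sgnhat (ν - 1/2) * min (sgnhat (D / h) * sgnhat (ν - 1/2)) 0 ≠ 0 →
      0 < (sgnhat (ν - 1/2) * min (sgnhat (D / h) * sgnhat (ν - 1/2)) 0) *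
          (Dbar * (1 / hbar) * (sigm α η * (1 - sigm α η)) * α) ∧
      sgnhat (Dbar * (1 / hbar) * (sigm α η * (1 - sigm α η)) * α)
        = sgnhat (ν - 1/2) * min (sgnhat (D / h) * sgnhat (ν - 1/2)) 0) := by
  have hslope : 0 < sigm α η * (1 - sigm α η) :=
    mul_pos (sigm_pos α η) (sub_pos.2 (sigm_lt_one α η))
  rw [mul_one_div]
  rcases pos_and_pos_or_neg_and_neg_of_mul_pos hsign with ⟨hd, hdb⟩ | ⟨hd, hdb⟩
  · have hgrad : 0 < Dbar / hbar * (sigm α η * (1 - sigm α η)) * α :=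
      mul_pos (mul_pos hdb hslope) hα
    rw [sgnhat_of_nonneg hd.le, sgnhat_of_nonneg hgrad.le]
    rcases hν with rfl | rfl
    · rw [sgnhat_of_neg (by norm_num)]
      norm_num [hgrad, hgrad.le]
    · rw [sgnhat_of_nonneg (by norm_num)]
      norm_num
  · have hgrad : Dbar / hbar * (sigm α η * (1 - sigm α η)) * α < 0 :=
      mul_neg_of_neg_of_pos (mul_neg_of_neg_of_pos hdb hslope) hα
    rw [sgnhat_of_neg hd, sgnhat_of_neg hgrad]
    rcases hν with rfl | rfl
    · rw [sgnhat_of_neg (by norm_num)]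
      norm_num
    · rw [sgnhat_of_nonneg (by norm_num)]
      norm_num [hgrad, hgrad.le]
end
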